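/- arXiv:2405.17968 — 4 statements merged into one kernel-verified Lean document; each statement's English description precedes it below -/
import Mathlib

section
/- Let f_1, …, f_K be pairwise distinct points of ℝ², and for each pair j ≠ k let ℓ_{j,k} = {x ∈ ℝ² : ⟨f_j − f_k, x⟩ = 0} be the line through the origin orthogonal to f_j − f_k. Let U = ℝ² \ ⋃_{j≠k} ℓ_{j,k}, and let H ⊆ U be a set containing at least one point of every connected component of U. Then for every q ∈ ℝ² there exists h ∈ H such that for all indices j, k ∈ [K], ⟨f_j, h⟩ > ⟨f_k, h⟩ implies ⟨f_j, q⟩ ≥ ⟨f_k, q⟩. -/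
open scoped RealInnerProductSpace

/-- The complement of the hyperplane orthogonal to a nonzero vector is dense. -/
theorem dense_setOf_inner_ne_zero {E : Type*} [NormedAddCommGroup E] [InnerProductSpace ℝ E]
    {v : E} (hv : v ≠ 0) : Dense {x : E | ⟪v, x⟫ ≠ 0} := by
  have hcompl : {x : E | ⟪v, x⟫ ≠ 0} =
      ((LinearMap.ker (innerₛₗ ℝ v) : Submodule ℝ E) : Set E)ᶜ := by
    ext x
    simp
  rw [hcompl, ← interior_eq_empty_iff_dense_compl, ← Set.not_nonempty_iff_eq_empty]
  intro hne
  have htop := Submodule.eq_top_of_nonempty_interior' _ hne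
  have hmem : v ∈ LinearMap.ker (innerₛₗ ℝ v) := htop ▸ Submodule.mem_top
  exact hv (by simpa using hmem)

/-- A continuous real function without zeros on `U` that is positive at a point of a connected
component of `U` is positive at the base point of that component. -/
theorem pos_of_mem_connectedComponentIn {X : Type*} [TopologicalSpace X] {U : Set X} {g : X → ℝ}
    (hg : Continuous g) (hU : ∀ y ∈ U, g y ≠ 0) {x h : X} (hx : x ∈ U)
    (hh : h ∈ connectedComponentIn U x) (hpos : 0 < g h) : 0 < g x := by
  by_contra! hle
  obtain ⟨y, hy, hy0⟩ := isPreconnected_connectedComponentIn.intermediate_value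
    (mem_connectedComponentIn hx) hh hg.continuousOn ⟨hle, hpos.le⟩
  exact hU y (connectedComponentIn_subset U x hy) hy0

/-- Hitting-set covering lemma: if `H` contains a point of every connected
component (cell) of the complement `U` of the arrangement of the lines through
the origin orthogonal to the differences `f j - f k`, then for every query `q`
there is `h ∈ H` whose induced strict order on inner products is consistent
with the (weak) order induced by `q`. -/
theorem stmt_4 {K : ℕ} (f : Fin K → EuclideanSpace ℝ (Fin 2))
    (hf : Function.Injective f)
    (U : Set (EuclideanSpace ℝ (Fin 2)))
    (hU : U = Set.univ \ ⋃ (j : Fin K) (k : Fin K) (_ : j ≠ k),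
      {x : EuclideanSpace ℝ (Fin 2) | ⟪f j - f k, x⟫ = 0})
    (H : Set (EuclideanSpace ℝ (Fin 2))) (hHU : H ⊆ U)
    (hhit : ∀ x ∈ U, ∃ h ∈ H, h ∈ connectedComponentIn U x) :
    ∀ q : EuclideanSpace ℝ (Fin 2), ∃ h ∈ H,
      ∀ j k : Fin K, ⟪f j, h⟫ > ⟪f k, h⟫ → ⟪f j, q⟫ ≥ ⟪f k, q⟫ := by
  intro q
  have hne : ∀ x ∈ U, ∀ j k : Fin K, j ≠ k → ⟪f j - f k, x⟫ ≠ 0 := by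
    intro x hx j k hjk h0
    rw [hU] at hx
    exact hx.2 (by simp only [Set.mem_iUnion]; exact ⟨j, k, hjk, h0⟩)
  have hdense : Dense U := by
    have hInter : U = ⋂ p : {p : Fin K × Fin K // p.1 ≠ p.2},
        {x | ⟪f p.1.1 - f p.1.2, x⟫ ≠ 0} := by
      rw [hU]
      ext x
      simp
    rw [hInter]
    exact dense_iInter_of_isOpen
      (fun p => isOpen_ne_fun (by fun_prop) continuous_const)
      (fun p => dense_setOf_inner_ne_zero (sub_ne_zero.mpr (hf.ne p.2)))
  have hopen : IsOpen {x | ∀ j k : Fin K, ⟪f k, q⟫ > ⟪f j, q⟫ → ⟪f k, x⟫ > ⟪f j, x⟫} := by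
    simp only [Set.ofPred_forall]
    exact isOpen_iInter_of_finite fun j => isOpen_iInter_of_finite fun k =>
      isOpen_iInter_of_finite fun _ => isOpen_lt (by fun_prop) (by fun_prop)
  obtain ⟨x, hxV, hxU⟩ := hdense.inter_open_nonempty _ hopen ⟨q, fun _ _ h => h⟩
  obtain ⟨h, hH, hhx⟩ := hhit x hxU
  refine ⟨h, hH, fun j k hjk => ?_⟩
  by_contra! hlt
  have hjk_ne : j ≠ k := by
    rintro rfl
    exact lt_irrefl _ hjk
  have hpos : 0 < ⟪f j - f k, x⟫ :=
    pos_of_mem_connectedComponentIn (g := fun y => ⟪f j - f k, y⟫) (by fun_prop)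
      (fun y hy => hne y hy j k hjk_ne) hxU hhx (by rw [inner_sub_left]; linarith)
  have hx := hxV j k hlt
  rw [inner_sub_left] at hpos
  linarith
end

section
/- Let K ≥ 2 and let f_1, …, f_K be pairwise distinct points of ℝ². Call a permutation σ of [K] representable if there exists q ∈ ℝ² with ⟨f_{σ(1)}, q⟩ > ⟨f_{σ(2)}, q⟩ > … > ⟨f_{σ(K)}, q⟩. Then the number of representable permutations is at most K(K−1). -/
open scoped RealInnerProductSpace

section SignPatterns

variable {E : Type*} [NormedAddCommGroup E] [InnerProductSpace ℝ E]

open Classical in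
/-- The vectors of `s` having positive inner product with `q`. -/
noncomputable def positivePart (s : Finset E) (q : E) : Finset E :=
  s.filter fun v => 0 < ⟪v, q⟫

/-- The subsets of `s` cut out by an open half-space `{v | 0 < ⟪v, q⟫}` whose boundary
misses `s`. -/
def halfSpaceCuts (s : Finset E) : Set (Finset E) :=
  {t | ∃ q : E, (∀ v ∈ s, ⟪v, q⟫ ≠ 0) ∧ positivePart s q = t}

theorem mem_positivePart {s : Finset E} {q v : E} :
    v ∈ positivePart s q ↔ v ∈ s ∧ 0 < ⟪v, q⟫ := by
  simp [positivePart]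

theorem positivePart_mem_powerset (s : Finset E) (q : E) : positivePart s q ∈ s.powerset :=
  Finset.mem_powerset.2 fun _ hv => (mem_positivePart.1 hv).1

theorem finite_halfSpaceCuts (s : Finset E) : (halfSpaceCuts s).Finite := by
  refine s.powerset.finite_toSet.subset ?_
  rintro _ ⟨q, -, rfl⟩
  exact positivePart_mem_powerset s q

theorem positivePart_smul_of_pos (s : Finset E) (q : E) {c : ℝ} (hc : 0 < c) :
    positivePart s (c • q) = positivePart s q := by
  ext v
  simp [mem_positivePart, inner_smul_right, hc]

/-- Two generic points with the same sign pattern that are separated by the hyperplane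
orthogonal to `a` can be joined to a generic point of that hyperplane with the same pattern. -/
theorem exists_orthogonal_of_positivePart_eq {s : Finset E} {a p n : E}
    (hp : ∀ v ∈ s, ⟪v, p⟫ ≠ 0) (hn : ∀ v ∈ s, ⟪v, n⟫ ≠ 0)
    (h : positivePart s p = positivePart s n) (hap : 0 < ⟪a, p⟫) (han : ⟪a, n⟫ < 0) :
    ∃ q : E, ⟪a, q⟫ = 0 ∧ (∀ v ∈ s, ⟪v, q⟫ ≠ 0) ∧ positivePart s q = positivePart s p := by
  have key : ∀ v ∈ s, (0 < ⟪v, p⟫ ∧ 0 < ⟪v, (-⟪a, n⟫) • p + ⟪a, p⟫ • n⟫) ∨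
      (⟪v, p⟫ < 0 ∧ ⟪v, (-⟪a, n⟫) • p + ⟪a, p⟫ • n⟫ < 0) := by
    intro v hv
    have hiff : 0 < ⟪v, p⟫ ↔ 0 < ⟪v, n⟫ := by
      have := congrArg (v ∈ ·) h
      simpa [mem_positivePart, hv] using this
    rw [inner_add_right, inner_smul_right, inner_smul_right]
    rcases lt_or_gt_of_ne (hp v hv) with h1 | h1
    · have h2 : ⟪v, n⟫ < 0 :=
        lt_of_le_of_ne (not_lt.1 fun h2 => h1.not_gt (hiff.2 h2)) (hn v hv)
      exact Or.inr ⟨h1, by nlinarith⟩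
    · have h2 := hiff.1 h1
      exact Or.inl ⟨h1, by nlinarith⟩
  refine ⟨(-⟪a, n⟫) • p + ⟪a, p⟫ • n, ?_, ?_, ?_⟩
  · rw [inner_add_right, inner_smul_right, inner_smul_right]
    ring
  · intro v hv
    rcases key v hv with h | h
    · exact h.2.ne'
    · exact h.2.ne
  · ext v
    rw [mem_positivePart, mem_positivePart]
    refine and_congr_right fun hv => ?_
    rcases key v hv with h | h
    · exact iff_of_true h.2 h.1
    · exact iff_of_false h.2.not_gt h.1.not_gt

end SignPatterns

/-- In the plane, the orthogonal complement of a nonzero vector is spanned by one vector. -/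
theorem exists_forall_orthogonal_eq_smul {a : EuclideanSpace ℝ (Fin 2)} (ha : a ≠ 0) :
    ∃ w : EuclideanSpace ℝ (Fin 2), ∀ q, ⟪a, q⟫ = 0 → ∃ c : ℝ, q = c • w := by
  have hpos : a 0 ^ 2 + a 1 ^ 2 ≠ 0 := by
    intro h
    apply ha
    ext i
    fin_cases i
    · simpa using (by nlinarith [sq_nonneg (a 0), sq_nonneg (a 1)] : a 0 ^ 2 = 0)
    · simpa using (by nlinarith [sq_nonneg (a 0), sq_nonneg (a 1)] : a 1 ^ 2 = 0)
  refine ⟨!₂[-a 1, a 0], fun q hq => ⟨(a 0 * q 1 - a 1 * q 0) / (a 0 ^ 2 + a 1 ^ 2), ?_⟩⟩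
  have h : q 0 * a 0 + q 1 * a 1 = 0 := by
    simpa [PiLp.inner_apply, Fin.sum_univ_two] using hq
  ext i
  fin_cases i
  · simp
    field_simp
    linear_combination a 0 * h
  · simp
    field_simp
    linear_combination a 1 * h

/-- A line through the origin of the plane meets at most two regions of a central
arrangement. -/
theorem ncard_orthogonal_positivePart_le_two {a : EuclideanSpace ℝ (Fin 2)} (ha : a ≠ 0)
    {s : Finset (EuclideanSpace ℝ (Fin 2))} (hs : s.Nonempty) :
    {t | ∃ q, ⟪a, q⟫ = 0 ∧ (∀ v ∈ s, ⟪v, q⟫ ≠ 0) ∧ positivePart s q = t}.ncard ≤ 2 := by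
  obtain ⟨w, hw⟩ := exists_forall_orthogonal_eq_smul ha
  refine (Set.ncard_le_ncard (t := {positivePart s w, positivePart s (-w)}) ?_
    (Set.toFinite _)).trans ((Set.ncard_insert_le _ _).trans (by simp))
  rintro _ ⟨q, hq, hgen, rfl⟩
  obtain ⟨c, rfl⟩ := hw q hq
  rcases lt_trichotomy c 0 with hc | rfl | hc
  · right
    rw [← neg_smul_neg]
    exact positivePart_smul_of_pos s (-w) (neg_pos.2 hc)
  · obtain ⟨v, hv⟩ := hs
    exact absurd (by simp) (hgen v hv)
  · left
    exact positivePart_smul_of_pos s w hc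

theorem ncard_halfSpaceCuts_cons_le {a : EuclideanSpace ℝ (Fin 2)} (ha : a ≠ 0)
    {s : Finset (EuclideanSpace ℝ (Fin 2))} (hs : s.Nonempty) (has : a ∉ s) :
    (halfSpaceCuts (s.cons a has)).ncard ≤ (halfSpaceCuts s).ncard + 2 := by
  classical
  set P := {t | ∃ q, (∀ v ∈ s, ⟪v, q⟫ ≠ 0) ∧ 0 < ⟪a, q⟫ ∧ positivePart s q = t}
  set N := {t | ∃ q, (∀ v ∈ s, ⟪v, q⟫ ≠ 0) ∧ ⟪a, q⟫ < 0 ∧ positivePart s q = t}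
  have hPs : P ⊆ halfSpaceCuts s := fun t ⟨q, h, _, ht⟩ => ⟨q, h, ht⟩
  have hNs : N ⊆ halfSpaceCuts s := fun t ⟨q, h, _, ht⟩ => ⟨q, h, ht⟩
  have hPf := (finite_halfSpaceCuts s).subset hPs
  have hNf := (finite_halfSpaceCuts s).subset hNs
  have hcover : halfSpaceCuts (s.cons a has) ⊆ insert a '' P ∪ N := by
    rintro _ ⟨q, hq, rfl⟩
    have hqs : ∀ v ∈ s, ⟪v, q⟫ ≠ 0 := fun v hv => hq v (Finset.mem_cons_of_mem hv)
    rcases lt_or_gt_of_ne (hq a (Finset.mem_cons_self a s)) with h | h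
    · refine Or.inr ⟨q, hqs, h, ?_⟩
      ext v
      simp only [mem_positivePart, Finset.mem_cons]
      constructor
      · exact fun hv => ⟨Or.inr hv.1, hv.2⟩
      · rintro ⟨rfl | hv, hpos⟩
        · exact absurd hpos h.not_gt
        · exact ⟨hv, hpos⟩
    · refine Or.inl ⟨_, ⟨q, hqs, h, rfl⟩, ?_⟩
      ext v
      simp only [mem_positivePart, Finset.mem_cons, Finset.mem_insert]
      constructor
      · rintro (rfl | hv)
        · exact ⟨Or.inl rfl, h⟩
        · exact ⟨Or.inr hv.1, hv.2⟩
      · rintro ⟨rfl | hv, hpos⟩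
        · exact Or.inl rfl
        · exact Or.inr ⟨hv, hpos⟩
  have hinter : (P ∩ N).ncard ≤ 2 := by
    refine (Set.ncard_le_ncard ?_ ?_).trans (ncard_orthogonal_positivePart_le_two ha hs)
    · rintro _ ⟨⟨p, hp, hap, rfl⟩, ⟨n, hn, han, hpn⟩⟩
      exact exists_orthogonal_of_positivePart_eq hp hn hpn.symm hap han
    · exact (finite_halfSpaceCuts s).subset fun t ⟨q, _, h, ht⟩ => ⟨q, h, ht⟩
  calc (halfSpaceCuts (s.cons a has)).ncard
      ≤ (insert a '' P ∪ N).ncard := Set.ncard_le_ncard hcover ((hPf.image _).union hNf)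
    _ ≤ (insert a '' P).ncard + N.ncard := Set.ncard_union_le _ _
    _ ≤ P.ncard + N.ncard := Nat.add_le_add_right (Set.ncard_image_le hPf) _
    _ = (P ∪ N).ncard + (P ∩ N).ncard := (Set.ncard_union_add_ncard_inter P N hPf hNf).symm
    _ ≤ (halfSpaceCuts s).ncard + 2 := Nat.add_le_add
        (Set.ncard_le_ncard (Set.union_subset hPs hNs) (finite_halfSpaceCuts s)) hinter

/-- A central arrangement of `n ≥ 1` lines in the plane has at most `2 n` regions. -/
theorem ncard_halfSpaceCuts_le {s : Finset (EuclideanSpace ℝ (Fin 2))} (hs : s.Nonempty)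
    (h0 : 0 ∉ s) : (halfSpaceCuts s).ncard ≤ 2 * s.card := by
  induction hs using Finset.Nonempty.cons_induction with
  | singleton a =>
    have hsub : halfSpaceCuts {a} ⊆ ↑(({a} : Finset (EuclideanSpace ℝ (Fin 2))).powerset) := by
      rintro _ ⟨q, -, rfl⟩
      exact positivePart_mem_powerset _ q
    refine (Set.ncard_le_ncard hsub (Finset.finite_toSet _)).trans ?_
    rw [Set.ncard_coe_finset, Finset.card_powerset]
    simp
  | cons a s has hs ih =>
    rw [Finset.mem_cons, not_or] at h0
    have h1 := ih h0.2
    have h2 := ncard_halfSpaceCuts_cons_le (Ne.symm h0.1) hs has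
    rw [Finset.card_cons]
    omega

theorem two_mul_card_filter_lt (K : ℕ) :
    2 * (Finset.univ.filter fun p : Fin K × Fin K => p.1 < p.2).card = K * (K - 1) := by
  have hswap : (Finset.univ.filter fun p : Fin K × Fin K => p.1 < p.2).card =
      (Finset.univ.filter fun p : Fin K × Fin K => p.2 < p.1).card :=
    Finset.card_equiv (Equiv.prodComm _ _) (by simp)
  have hunion : (Finset.univ : Finset (Fin K)).offDiag =
      (Finset.univ.filter fun p : Fin K × Fin K => p.1 < p.2) ∪
      (Finset.univ.filter fun p : Fin K × Fin K => p.2 < p.1) := by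
    ext p
    simp
  have hdisj : Disjoint (Finset.univ.filter fun p : Fin K × Fin K => p.1 < p.2)
      (Finset.univ.filter fun p : Fin K × Fin K => p.2 < p.1) :=
    Finset.disjoint_filter.2 fun p _ h => h.not_gt
  have hcard := congrArg Finset.card hunion
  rw [Finset.card_union_of_disjoint hdisj, ← hswap, Finset.offDiag_card, Finset.card_univ,
    Fintype.card_fin] at hcard
  rw [two_mul, ← hcard, Nat.mul_sub, mul_one]

/-- A permutation sorting `g` in decreasing order is determined by the order induced by `g`. -/
theorem perm_eq_of_strictAnti_comp {K : ℕ} {g h : Fin K → ℝ} {σ τ : Equiv.Perm (Fin K)}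
    (hσ : StrictAnti (g ∘ σ)) (hτ : StrictAnti (h ∘ τ))
    (hgh : ∀ i j, g j < g i → h j < h i) : σ = τ := by
  have hmono : StrictMono (σ.trans τ.symm) := by
    intro i j hij
    have h1 := hgh _ _ (hσ hij)
    rw [← hτ.lt_iff_gt]
    simpa using h1
  have h1 := Subsingleton.elim
    (hmono.orderIsoOfSurjective _ (σ.trans τ.symm).surjective) (OrderIso.refl (Fin K))
  ext i
  have h2 : τ.symm (σ i) = i := congrArg (fun e : Fin K ≃o Fin K => e i) h1
  rw [← τ.symm_apply_eq.1 h2]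

/-- For `K ≥ 2` pairwise distinct points of `ℝ²`, the number of permutations
`σ` representable by some query `q` (meaning `⟪f (σ 1), q⟫ > ⋯ > ⟪f (σ K), q⟫`)
is at most `K (K - 1)`. -/
theorem stmt_5 {K : ℕ} (hK : 2 ≤ K) (f : Fin K → EuclideanSpace ℝ (Fin 2))
    (hf : Function.Injective f) :
    {σ : Equiv.Perm (Fin K) | ∃ q : EuclideanSpace ℝ (Fin 2),
        ∀ i j : Fin K, i < j → ⟪f (σ i), q⟫ > ⟪f (σ j), q⟫}.ncard
      ≤ K * (K - 1) := by
  classical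
  set pairs := Finset.univ.filter fun p : Fin K × Fin K => p.1 < p.2 with hpairs
  set s := pairs.image fun p => f p.1 - f p.2
  have hmem : ∀ i j, i < j → f i - f j ∈ s := fun i j hij =>
    Finset.mem_image.2 ⟨(i, j), by simpa [hpairs] using hij, rfl⟩
  have hne : s.Nonempty := ⟨_, hmem ⟨0, by omega⟩ ⟨1, by omega⟩ (by simp)⟩
  have h0 : (0 : EuclideanSpace ℝ (Fin 2)) ∉ s := by
    intro h
    obtain ⟨p, hp, hp0⟩ := Finset.mem_image.1 h
    exact (Finset.mem_filter.1 hp).2.ne (hf (sub_eq_zero.1 hp0))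
  have hbound : (halfSpaceCuts s).ncard ≤ K * (K - 1) := by
    rw [← two_mul_card_filter_lt K]
    exact (ncard_halfSpaceCuts_le hne h0).trans
      (Nat.mul_le_mul_left 2 Finset.card_image_le)
  refine le_trans ?_ hbound
  have hinj : ∀ σ : Equiv.Perm (Fin K), ∀ q : EuclideanSpace ℝ (Fin 2),
      (∀ i j : Fin K, i < j → ⟪f (σ i), q⟫ > ⟪f (σ j), q⟫) →
      Function.Injective fun i => ⟪f i, q⟫ := by
    intro σ q hq
    have hanti : StrictAnti ((fun i => ⟪f i, q⟫) ∘ σ) := fun i j hij => hq i j hij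
    exact (Function.Injective.of_comp_iff' _ σ.bijective).1 hanti.injective
  choose! q hq using fun (σ : Equiv.Perm (Fin K)) (hσ : ∃ q : EuclideanSpace ℝ (Fin 2),
    ∀ i j : Fin K, i < j → ⟪f (σ i), q⟫ > ⟪f (σ j), q⟫) => hσ
  refine Set.ncard_le_ncard_of_injOn (fun σ => positivePart s (q σ)) ?_ ?_
    (finite_halfSpaceCuts s)
  · intro σ hσ
    refine ⟨q σ, fun v hv => ?_, rfl⟩
    obtain ⟨p, hp, rfl⟩ := Finset.mem_image.1 hv
    rw [inner_sub_left, sub_ne_zero]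
    exact fun h => (Finset.mem_filter.1 hp).2.ne (hinj σ _ (hq σ hσ) h)
  · intro σ hσ τ hτ hpos
    have hiff : ∀ i j, i < j →
        (⟪f j, q σ⟫ < ⟪f i, q σ⟫ ↔ ⟪f j, q τ⟫ < ⟪f i, q τ⟫) := by
      intro i j hij
      have := congrArg (f i - f j ∈ ·) hpos
      simpa [mem_positivePart, hmem i j hij, inner_sub_left] using this
    refine perm_eq_of_strictAnti_comp (g := fun i => ⟪f i, q σ⟫) (h := fun i => ⟪f i, q τ⟫)
      (fun i j hij => hq σ hσ i j hij) (fun i j hij => hq τ hτ i j hij) fun i j hlt => ?_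
    rcases lt_trichotomy i j with hij | rfl | hij
    · exact (hiff i j hij).1 hlt
    · exact absurd hlt (lt_irrefl _)
    · refine lt_of_le_of_ne (not_lt.1 fun h => hlt.not_gt ((hiff j i hij).2 h)) fun h => ?_
      exact hij.ne (hinj τ _ (hq τ hτ) h)
end

section
/- Let d be a positive integer, ε ≥ 0, ν ≥ 0, and let μ_1 ≥ μ_2 ≥ … ≥ μ_d be real numbers with μ_d > (1+ε)·ν. Define Δ_j = μ_j − ν and δ_j = μ_j/(1+ε) − ν for j ∈ {1, …, d} (so δ_1 ≥ … ≥ δ_d > 0). Then Δ_1/δ_1² + ∑_{j=2}^{d} Δ_j · (1/δ_j² − 1/δ_{j−1}²) ≤ 2·Δ_d/δ_d². -/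
open scoped BigOperators

theorem affine_mul_inv_sq_sub_le {a b s t : ℝ} (ha : 0 ≤ a) (hs : 0 < s) (ht : 0 < t) :
    (a * t + b) * (1 / t ^ 2 - 1 / s ^ 2)
      ≤ (2 * a / t + b / t ^ 2) - (2 * a / s + b / s ^ 2) := by
  have key : (2 * a / t + b / t ^ 2) - (2 * a / s + b / s ^ 2)
      - (a * t + b) * (1 / t ^ 2 - 1 / s ^ 2) = a * t * (1 / t - 1 / s) ^ 2 := by
    field_simp
    ring
  have : 0 ≤ a * t * (1 / t - 1 / s) ^ 2 := by positivity
  linarith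

theorem sum_affine_mul_inv_sq_sub_le {a b : ℝ} (ha : 0 ≤ a) (δ : ℕ → ℝ) {n : ℕ} (hn : 1 ≤ n)
    (hδ : ∀ j, 1 ≤ j → j ≤ n → 0 < δ j) :
    (a * δ 1 + b) / δ 1 ^ 2
        + ∑ j ∈ Finset.Icc 2 n, (a * δ j + b) * (1 / δ j ^ 2 - 1 / δ (j - 1) ^ 2)
      ≤ 2 * a / δ n + b / δ n ^ 2 := by
  induction n, hn using Nat.le_induction with
  | base =>
    have h1 := hδ 1 le_rfl le_rfl
    have key : 2 * a / δ 1 + b / δ 1 ^ 2 - (a * δ 1 + b) / δ 1 ^ 2 = a / δ 1 := by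
      field_simp
      ring
    have : 0 ≤ a / δ 1 := by positivity
    simp only [Finset.Icc_eq_empty_of_lt one_lt_two, Finset.sum_empty]
    linarith
  | succ n hn ih =>
    have ih := ih fun j h1 hj => hδ j h1 (by lia)
    have step := affine_mul_inv_sq_sub_le (b := b) ha (hδ n hn (by lia))
      (hδ (n + 1) (by lia) le_rfl)
    rw [Finset.sum_Icc_succ_top (by lia), Nat.add_sub_cancel]
    linarith

/-- Telescoping bound on the gap ratios: with `μ 1 ≥ ⋯ ≥ μ d > (1+ε) ν`,
`Δ j = μ j - ν`, and `δ j = μ j / (1+ε) - ν`, we have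
`Δ 1 / δ 1 ^ 2 + ∑_{j=2}^{d} Δ j * (1 / δ j ^ 2 - 1 / δ (j-1) ^ 2)
  ≤ 2 * Δ d / δ d ^ 2`. -/
theorem stmt_9 (d : ℕ) (hd : 0 < d) (ε ν : ℝ) (hε : 0 ≤ ε) (hν : 0 ≤ ν)
    (μ : ℕ → ℝ)
    (hμ_mono : ∀ j, 1 ≤ j → j < d → μ (j + 1) ≤ μ j)
    (hμ_d : (1 + ε) * ν < μ d)
    (Δ δ : ℕ → ℝ)
    (hΔ : ∀ j, Δ j = μ j - ν)
    (hδ : ∀ j, δ j = μ j / (1 + ε) - ν) :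
    Δ 1 / δ 1 ^ 2
        + ∑ j ∈ Finset.Icc 2 d, Δ j * (1 / δ j ^ 2 - 1 / δ (j - 1) ^ 2)
      ≤ 2 * Δ d / δ d ^ 2 := by
  have ha : 0 < 1 + ε := by linarith
  have hμ_le : ∀ j, 1 ≤ j → j ≤ d → μ d ≤ μ j := by
    intro j h1 hj
    induction hj using Nat.decreasingInduction with
    | self => exact le_rfl
    | of_succ k hk ih => exact (ih (by lia)).trans (hμ_mono k h1 hk)
  have hδ_pos : ∀ j, 1 ≤ j → j ≤ d → 0 < δ j := by
    intro j h1 hj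
    rw [hδ, sub_pos, lt_div_iff₀ ha]
    linarith [hμ_le j h1 hj]
  have hΔδ : ∀ j, Δ j = (1 + ε) * δ j + ε * ν := by
    intro j
    rw [hΔ, hδ]
    field_simp
    ring
  have hd_pos := hδ_pos d hd le_rfl
  simp only [hΔδ]
  refine (sum_affine_mul_inv_sq_sub_le ha.le δ hd hδ_pos).trans ?_
  have key : 2 * ((1 + ε) * δ d + ε * ν) / δ d ^ 2
      - (2 * (1 + ε) / δ d + ε * ν / δ d ^ 2) = ε * ν / δ d ^ 2 := by
    field_simp
    ring
  have : 0 ≤ ε * ν / δ d ^ 2 := by positivity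
  linarith
end

section
/- Let d be a positive integer, ε ≥ 0, ν ≥ 0, and let μ_1 ≥ μ_2 ≥ … ≥ μ_d be real numbers with μ_d > (1+ε)·ν. Define Δ_j = μ_j − ν and δ_j = μ_j/(1+ε) − ν for j ∈ {1, …, d}. Let c > 0 and T₀ ≥ 0, and set n_j = max{c/δ_j², T₀}. If I_1, …, I_d ≥ 0 are real numbers with ∑_{j=1}^{ℓ} I_j ≤ n_ℓ for every ℓ ∈ {1, …, d}, then ∑_{j=1}^{d} Δ_j · I_j ≤ T₀ · ∑_{j=1}^{d} Δ_j + 2·c·Δ_d/δ_d². -/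
open scoped BigOperators

/-- Combined bound: with `μ 1 ≥ ⋯ ≥ μ d > (1+ε) ν`, `Δ j = μ j - ν`,
`δ j = μ j / (1+ε) - ν`, `n j = max (c / δ j ^ 2) T₀`, and nonnegative
`I j` with `∑_{j=1}^{ℓ} I j ≤ n ℓ` for all `ℓ ∈ {1, …, d}`, we have
`∑_{j=1}^{d} Δ j * I j ≤ T₀ * ∑_{j=1}^{d} Δ j + 2 c Δ d / δ d ^ 2`. -/
theorem stmt_10 (d : ℕ) (hd : 0 < d) (ε ν : ℝ) (hε : 0 ≤ ε) (hν : 0 ≤ ν)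
    (μ : ℕ → ℝ)
    (hμ_mono : ∀ j, 1 ≤ j → j < d → μ (j + 1) ≤ μ j)
    (hμ_d : (1 + ε) * ν < μ d)
    (Δ δ : ℕ → ℝ)
    (hΔ : ∀ j, Δ j = μ j - ν)
    (hδ : ∀ j, δ j = μ j / (1 + ε) - ν)
    (c T₀ : ℝ) (hc : 0 < c) (hT₀ : 0 ≤ T₀)
    (n : ℕ → ℝ) (hn : ∀ j, n j = max (c / δ j ^ 2) T₀)
    (I : ℕ → ℝ) (hI_nonneg : ∀ j ∈ Finset.Icc 1 d, 0 ≤ I j)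
    (hI_sum : ∀ l ∈ Finset.Icc 1 d, ∑ j ∈ Finset.Icc 1 l, I j ≤ n l) :
    ∑ j ∈ Finset.Icc 1 d, Δ j * I j
      ≤ T₀ * ∑ j ∈ Finset.Icc 1 d, Δ j + 2 * c * Δ d / δ d ^ 2 := by
  have hε1 : 0 < 1 + ε := by linarith
  have hμ_ge : ∀ k ≤ d, 1 ≤ k → μ d ≤ μ k := by
    intro k hk
    induction hk using Nat.decreasingInduction with
    | self => exact fun _ => le_rfl
    | of_succ k hk ih =>
      exact fun h1 => (ih (by omega)).trans (hμ_mono k h1 hk)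
  have hδ_pos : ∀ k, 1 ≤ k → k ≤ d → 0 < δ k := by
    intro k h1 hk
    rw [hδ, sub_pos, lt_div_iff₀ hε1]
    linarith [hμ_ge k hk h1]
  have hΔδ : ∀ k, Δ k = (1 + ε) * δ k + ε * ν := by
    intro k
    rw [hΔ, hδ]
    field_simp
    ring
  have hεν : 0 ≤ ε * ν := mul_nonneg hε hν
  have hS : ∀ l, 1 ≤ l → l ≤ d →
      ∑ j ∈ Finset.Icc 1 l, I j ≤ c / δ l ^ 2 + T₀ := by
    intro l h1 hl
    refine (hI_sum l (Finset.mem_Icc.mpr ⟨h1, hl⟩)).trans ?_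
    rw [hn]
    exact max_le (by linarith) (by linarith [div_nonneg hc.le (sq_nonneg (δ l))])
  have key : ∀ l, 1 ≤ l → l ≤ d →
      ∑ j ∈ Finset.Icc 1 l, Δ j * I j ≤ Δ l * ∑ j ∈ Finset.Icc 1 l, I j
        + T₀ * (∑ j ∈ Finset.Icc 1 l, Δ j - Δ l) + (1 + ε) * c / δ l := by
    intro l h1
    induction l, h1 using Nat.le_induction with
    | base =>
      intro hl
      have := div_nonneg (mul_pos hε1 hc).le (hδ_pos 1 le_rfl hl).le
      simpa using this
    | succ l h1 ih =>
      intro hl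
      have ih := ih (by omega)
      have hx := hδ_pos l h1 (by omega)
      have hy := hδ_pos (l + 1) (by omega) hl
      have hstep : 0 ≤ Δ l - Δ (l + 1) := by
        rw [hΔ, hΔ]
        linarith [hμ_mono l h1 (by omega)]
      have hdiff : Δ l - Δ (l + 1) = (1 + ε) * (δ l - δ (l + 1)) := by
        rw [hΔδ, hΔδ]
        ring
      have hmul := mul_le_mul_of_nonneg_left (hS l h1 (by omega)) hstep
      have htel : (Δ l - Δ (l + 1)) * (c / δ l ^ 2)
          ≤ (1 + ε) * c / δ (l + 1) - (1 + ε) * c / δ l := by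
        have h : (1 + ε) * c / δ (l + 1) - (1 + ε) * c / δ l
            - (Δ l - Δ (l + 1)) * (c / δ l ^ 2)
            = (1 + ε) * c * (δ l - δ (l + 1)) ^ 2 / (δ (l + 1) * δ l ^ 2) := by
          rw [hdiff]
          field_simp
        have : 0 ≤ (1 + ε) * c * (δ l - δ (l + 1)) ^ 2 / (δ (l + 1) * δ l ^ 2) := by
          positivity
        linarith
      have hT : 0 ≤ T₀ * Δ (l + 1) := by
        refine mul_nonneg hT₀ ?_
        rw [hΔδ]
        positivity
      simp only [Finset.sum_Icc_succ_top (show 1 ≤ l + 1 by omega)]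
      linarith
  have hδd := hδ_pos d hd le_rfl
  have hΔd : 0 ≤ Δ d := by
    rw [hΔδ]
    positivity
  have hmul := mul_le_mul_of_nonneg_left (hS d hd le_rfl) hΔd
  have hlast : (1 + ε) * c / δ d ≤ c * Δ d / δ d ^ 2 := by
    rw [div_le_div_iff₀ hδd (by positivity), hΔδ]
    have : 0 ≤ c * (ε * ν) * δ d := by positivity
    linarith
  have htwo : 2 * c * Δ d / δ d ^ 2 = Δ d * (c / δ d ^ 2) + c * Δ d / δ d ^ 2 := by
    ring
  linarith [key d hd le_rfl]
end
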